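/- Let s ∈ [0,1) be fixed. The set A_u = {x ∈ [0,1) : the ternary expansion of x contains the digit 1 exactly u times} has Hausdorff dimension log 2 / log 3 for every u ∈ ℕ, and H^{log 2/log 3}(A_u) = ∞ for u ≥ 1. -/

import Mathlib

open MeasureTheory

/-- The positions of the digit `1` in the ternary expansion of `x`. -/
def ternaryOnes (x : ℝ) : Set ℕ := {k : ℕ | ⌊x * 3 ^ (k + 1)⌋ % 3 = 1}

/-- The points of `[0, 1)` with exactly `u` ternary digits equal to `1`. -/
def ternaryOnesCount (u : ℕ) : Set ℝ := {x ∈ Set.Ico (0 : ℝ) 1 | (ternaryOnes x).encard = u}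

theorem zero_mem_ternaryOnes_prepend {x : ℝ} (hx : x ∈ Set.Ico (0 : ℝ) 1) {i : ℤ} (h0 : 0 ≤ i)
    (h3 : i < 3) : 0 ∈ ternaryOnes ((x + i) / 3) ↔ i = 1 := by
  have h : (x + i) / 3 * 3 ^ (0 + 1) = x + i := by ring
  have hf : ⌊x⌋ = 0 := Int.floor_eq_zero_iff.2 hx
  rw [ternaryOnes, Set.mem_ofPred_eq, h, Int.floor_add_intCast, hf]
  omega

theorem succ_mem_ternaryOnes_prepend (x : ℝ) (i : ℤ) (k : ℕ) :
    k + 1 ∈ ternaryOnes ((x + i) / 3) ↔ k ∈ ternaryOnes x := by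
  have h : (x + i) / 3 * 3 ^ (k + 1 + 1) = x * 3 ^ (k + 1) + ((i * 3 ^ k * 3 : ℤ) : ℝ) := by
    push_cast; ring
  rw [ternaryOnes, Set.mem_ofPred_eq, h, Int.floor_add_intCast, Int.add_mul_emod_self_right]
  rfl

theorem encard_ternaryOnes_prepend {x : ℝ} (hx : x ∈ Set.Ico (0 : ℝ) 1) {i : ℤ} (h0 : 0 ≤ i)
    (h3 : i < 3) : (ternaryOnes ((x + i) / 3)).encard =
      (ternaryOnes x).encard + if i = 1 then 1 else 0 := by
  have key : ternaryOnes ((x + i) / 3) =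
      Nat.succ '' ternaryOnes x ∪ if i = 1 then {0} else ∅ := by
    ext k
    rcases k with _ | k
    · rw [zero_mem_ternaryOnes_prepend hx h0 h3]
      split_ifs with h <;> simp [h]
    · rw [succ_mem_ternaryOnes_prepend]
      split_ifs with h <;> simp
  rw [key, Set.encard_union_eq, Nat.succ_injective.encard_image]
  · split_ifs <;> simp
  · split_ifs <;> simp

theorem prepend_mem_ternaryOnesCount {x : ℝ} {u v : ℕ} (hx : x ∈ ternaryOnesCount u) {i : ℤ}
    (h0 : 0 ≤ i) (h3 : i < 3) (hv : v = u + if i = 1 then 1 else 0) :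
    (x + i) / 3 ∈ ternaryOnesCount v := by
  have h0' : (0 : ℝ) ≤ i := by exact_mod_cast h0
  have h3' : (i : ℝ) + 1 ≤ 3 := by exact_mod_cast h3
  obtain ⟨⟨hx0, hx1⟩, hxu⟩ := hx
  refine ⟨⟨by linarith, by linarith⟩, ?_⟩
  rw [encard_ternaryOnes_prepend ⟨hx0, hx1⟩ h0 h3, hxu, hv]
  split_ifs <;> simp

/-- The point of the Cantor set obtained from the binary expansion of `y` by doubling each digit
and reading the result in base `3`. -/
noncomputable def cantorPoint (y : ℝ) : ℝ :=
  ∑' k : ℕ, 2 * ((⌊y * 2 ^ (k + 1)⌋ % 2 : ℤ) : ℝ) / 3 ^ (k + 1)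

theorem hasSum_two_div_three_pow : HasSum (fun k : ℕ => (2 : ℝ) / 3 ^ (k + 1)) 1 := by
  have h := (hasSum_geometric_of_lt_one (r := (1 / 3 : ℝ)) (by norm_num) (by norm_num)).mul_left
    (2 / 3)
  have h1 : (2 / 3 * (1 - 1 / 3)⁻¹ : ℝ) = 1 := by norm_num
  rw [h1] at h
  convert! h using 2 with k
  rw [pow_succ, one_div, inv_pow]
  field_simp

theorem cantorPoint_term_nonneg (y : ℝ) (k : ℕ) :
    0 ≤ 2 * ((⌊y * 2 ^ (k + 1)⌋ % 2 : ℤ) : ℝ) / 3 ^ (k + 1) := by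
  have h : (0 : ℝ) ≤ ((⌊y * 2 ^ (k + 1)⌋ % 2 : ℤ) : ℝ) := by
    exact_mod_cast Int.emod_nonneg _ (by norm_num)
  positivity

theorem cantorPoint_term_le (y : ℝ) (k : ℕ) :
    2 * ((⌊y * 2 ^ (k + 1)⌋ % 2 : ℤ) : ℝ) / 3 ^ (k + 1) ≤ 2 / 3 ^ (k + 1) := by
  have h : ((⌊y * 2 ^ (k + 1)⌋ % 2 : ℤ) : ℝ) ≤ 1 := by
    exact_mod_cast (by omega : ⌊y * 2 ^ (k + 1)⌋ % 2 ≤ 1)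
  gcongr
  linarith

theorem summable_cantorPoint (y : ℝ) :
    Summable fun k : ℕ => 2 * ((⌊y * 2 ^ (k + 1)⌋ % 2 : ℤ) : ℝ) / 3 ^ (k + 1) :=
  hasSum_two_div_three_pow.summable.of_nonneg_of_le (cantorPoint_term_nonneg y)
    (cantorPoint_term_le y)

theorem cantorPoint_nonneg (y : ℝ) : 0 ≤ cantorPoint y := tsum_nonneg (cantorPoint_term_nonneg y)

theorem cantorPoint_le_one (y : ℝ) : cantorPoint y ≤ 1 :=
  hasSum_two_div_three_pow.tsum_eq ▸
    (summable_cantorPoint y).tsum_le_tsum (cantorPoint_term_le y) hasSum_two_div_three_pow.summable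

theorem cantorPoint_prepend {z : ℝ} (hz : z ∈ Set.Ico (0 : ℝ) 1) {b : ℤ} (hb : b = 0 ∨ b = 1) :
    cantorPoint ((z + b) / 2) = (cantorPoint z + (2 * b : ℤ)) / 3 := by
  have hf : ⌊z⌋ = 0 := Int.floor_eq_zero_iff.2 hz
  have h0 : (z + b) / 2 * 2 ^ (0 + 1) = z + b := by ring
  have hb' : b % 2 = b := by omega
  rw [cantorPoint, (summable_cantorPoint _).tsum_eq_zero_add, h0, Int.floor_add_intCast, hf,
    zero_add, hb', cantorPoint, add_div (tsum _), add_comm, ← tsum_div_const]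
  congr 1
  · refine tsum_congr fun k => ?_
    have hk : (z + b) / 2 * 2 ^ (k + 1 + 1) = z * 2 ^ (k + 1) + ((b * 2 ^ k * 2 : ℤ) : ℝ) := by
      push_cast; ring
    rw [hk, Int.floor_add_intCast, Int.add_mul_emod_self_right, pow_succ _ (k + 1), div_div]
  · push_cast; ring

theorem exists_eq_binary_prepend {y : ℝ} (hy : y ∈ Set.Ico (0 : ℝ) 1) :
    ∃ z ∈ Set.Ico (0 : ℝ) 1, ∃ b : ℤ, (b = 0 ∨ b = 1) ∧ y = (z + b) / 2 := by
  rcases lt_or_ge y (1 / 2) with h | h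
  · exact ⟨2 * y, ⟨by linarith [hy.1], by linarith⟩, 0, Or.inl rfl, by push_cast; ring⟩
  · exact ⟨2 * y - 1, ⟨by linarith, by linarith [hy.2]⟩, 1, Or.inr rfl, by push_cast; ring⟩

theorem cantorPoint_lt_one {y : ℝ} (hy : y ∈ Set.Ico (0 : ℝ) 1) : cantorPoint y < 1 := by
  obtain ⟨n, hn⟩ := exists_pow_lt_of_lt_one (sub_pos.2 hy.2) (by norm_num : (1 / 2 : ℝ) < 1)
  induction n generalizing y with
  | zero => linarith [hy.1]
  | succ n ih =>
    obtain ⟨z, hz, b, hb, rfl⟩ := exists_eq_binary_prepend hy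
    rw [cantorPoint_prepend hz hb]
    rcases hb with rfl | rfl
    · push_cast
      linarith [cantorPoint_le_one z]
    · rw [pow_succ] at hn
      push_cast at hn ⊢
      linarith [ih hz (by linarith)]

theorem cantorPoint_mem_ternaryOnesCount {y : ℝ} (hy : y ∈ Set.Ico (0 : ℝ) 1) :
    cantorPoint y ∈ ternaryOnesCount 0 := by
  refine ⟨⟨cantorPoint_nonneg y, cantorPoint_lt_one hy⟩, ?_⟩
  rw [Nat.cast_zero, Set.encard_eq_zero]
  refine Set.eq_empty_of_forall_notMem fun k => ?_
  induction k generalizing y with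
  | zero =>
    obtain ⟨z, hz, b, hb, rfl⟩ := exists_eq_binary_prepend hy
    rw [cantorPoint_prepend hz hb, zero_mem_ternaryOnes_prepend
      ⟨cantorPoint_nonneg z, cantorPoint_lt_one hz⟩ (by omega) (by omega)]
    omega
  | succ k ih =>
    obtain ⟨z, hz, b, hb, rfl⟩ := exists_eq_binary_prepend hy
    rw [cantorPoint_prepend hz hb, succ_mem_ternaryOnes_prepend]
    exact ih hz

theorem abs_sub_le_of_abs_cantorPoint_sub_le (n : ℕ) {x y : ℝ} (hx : x ∈ Set.Ico (0 : ℝ) 1)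
    (hy : y ∈ Set.Ico (0 : ℝ) 1) (h : |cantorPoint x - cantorPoint y| ≤ (1 / 3) ^ n) :
    |x - y| ≤ (1 / 2) ^ n := by
  induction n generalizing x y with
  | zero =>
    rw [pow_zero, abs_le]
    constructor <;> linarith [hx.1, hx.2, hy.1, hy.2]
  | succ n ih =>
    obtain ⟨z, hz, b, hb, rfl⟩ := exists_eq_binary_prepend hx
    obtain ⟨w, hw, c, hc, rfl⟩ := exists_eq_binary_prepend hy
    rw [cantorPoint_prepend hz hb, cantorPoint_prepend hw hc] at h
    have hp : (1 / 3 : ℝ) ^ n ≤ 1 := pow_le_one₀ (by norm_num) (by norm_num)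
    have hz0 := cantorPoint_nonneg z
    have hz1 := cantorPoint_lt_one hz
    have hw0 := cantorPoint_nonneg w
    have hw1 := cantorPoint_lt_one hw
    rw [pow_succ, abs_le] at h
    have hbc : b = c := by
      rcases hb with rfl | rfl <;> rcases hc with rfl | rfl <;> first | rfl | skip
      all_goals push_cast at h; linarith [h.1, h.2]
    subst hbc
    have := abs_le.1 (ih hz hw (abs_le.2 ⟨by linarith [h.1], by linarith [h.2]⟩))
    rw [pow_succ, abs_le]
    constructor <;> linarith [this.1, this.2]

theorem log_two_div_log_three_pos : 0 < Real.log 2 / Real.log 3 :=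
  div_pos (Real.log_pos (by norm_num)) (Real.log_pos (by norm_num))

theorem three_rpow_log_two_div_log_three : (3 : ℝ) ^ (Real.log 2 / Real.log 3) = 2 :=
  Real.rpow_logb (by norm_num) (by norm_num) (by norm_num)

theorem one_third_pow_rpow_log_two_div_log_three (n : ℕ) :
    ((1 / 3 : ℝ) ^ n) ^ (Real.log 2 / Real.log 3) = (1 / 2) ^ n := by
  rw [← Real.rpow_natCast, ← Real.rpow_mul (by norm_num), mul_comm, Real.rpow_mul (by norm_num),
    Real.rpow_natCast, one_div, Real.inv_rpow (by norm_num), three_rpow_log_two_div_log_three,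
    one_div]

theorem ennreal_three_rpow_log_two_div_log_three :
    (3 : ENNReal) ^ (Real.log 2 / Real.log 3) = 2 := by
  have h := ENNReal.ofReal_rpow_of_pos (x := 3) (p := Real.log 2 / Real.log 3) (by norm_num)
  rw [three_rpow_log_two_div_log_three] at h
  simpa using h

theorem abs_sub_le_abs_cantorPoint_sub_rpow {x y : ℝ} (hx : x ∈ Set.Ico (0 : ℝ) 1)
    (hy : y ∈ Set.Ico (0 : ℝ) 1) :
    |x - y| ≤ 2 * |cantorPoint x - cantorPoint y| ^ (Real.log 2 / Real.log 3) := by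
  rcases (abs_nonneg (cantorPoint x - cantorPoint y)).eq_or_lt with h | h
  · have hle : |x - y| ≤ 0 := by
      refine ge_of_tendsto' (tendsto_pow_atTop_nhds_zero_of_lt_one (r := (1 / 2 : ℝ)) (by norm_num)
        (by norm_num)) fun n => abs_sub_le_of_abs_cantorPoint_sub_le n hx hy ?_
      rw [← h]
      positivity
    exact hle.trans (by positivity)
  · have h1 : |cantorPoint x - cantorPoint y| ≤ 1 := by
      rw [abs_le]
      constructor <;> linarith [cantorPoint_nonneg x, cantorPoint_nonneg y, cantorPoint_le_one x,
        cantorPoint_le_one y]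
    obtain ⟨n, hn, hn'⟩ := exists_nat_pow_near_of_lt_one h h1 (by norm_num : (0 : ℝ) < 1 / 3)
      (by norm_num)
    calc |x - y| ≤ (1 / 2) ^ n := abs_sub_le_of_abs_cantorPoint_sub_le n hx hy hn'
      _ = 2 * ((1 / 3 : ℝ) ^ (n + 1)) ^ (Real.log 2 / Real.log 3) := by
        rw [one_third_pow_rpow_log_two_div_log_three]; ring
      _ ≤ _ := by
        gcongr

theorem hausdorffMeasure_ternaryOnesCount_zero_ne_zero :
    μH[Real.log 2 / Real.log 3] (ternaryOnesCount 0) ≠ 0 := by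
  have hinj : Set.InjOn cantorPoint (Set.Ico 0 1) := fun x hx y hy hxy => by
    have h := abs_sub_le_abs_cantorPoint_sub_rpow hx hy
    rw [hxy, sub_self, abs_zero, Real.zero_rpow log_two_div_log_three_pos.ne', mul_zero] at h
    exact sub_eq_zero.1 (abs_eq_zero.1 (h.antisymm (abs_nonneg _)))
  set f := Function.invFunOn cantorPoint (Set.Ico 0 1)
  have hf : Set.LeftInvOn f cantorPoint (Set.Ico 0 1) := hinj.leftInvOn_invFunOn
  let r : NNReal := ⟨Real.log 2 / Real.log 3, log_two_div_log_three_pos.le⟩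
  have hr : 0 < r := log_two_div_log_three_pos
  have hold : HolderOnWith 2 r f (cantorPoint '' Set.Ico 0 1) := by
    rintro _ ⟨x, hx, rfl⟩ _ ⟨y, hy, rfl⟩
    rw [hf hx, hf hy, edist_dist, edist_dist, Real.dist_eq, Real.dist_eq,
      ENNReal.ofReal_rpow_of_nonneg (abs_nonneg _) r.coe_nonneg]
    refine (ENNReal.ofReal_le_ofReal (abs_sub_le_abs_cantorPoint_sub_rpow hx hy)).trans_eq ?_
    rw [ENNReal.ofReal_mul (by norm_num), ENNReal.ofReal_ofNat]
    rfl
  have h := hold.hausdorffMeasure_image_le hr zero_le_one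
  rw [hf.image_image, hausdorffMeasure_real, Real.volume_Ico, mul_one] at h
  intro h0
  have h0' : μH[(r : ℝ)] (cantorPoint '' Set.Ico 0 1) = 0 := by
    refine measure_mono_null ?_ h0
    rintro _ ⟨y, hy, rfl⟩
    exact cantorPoint_mem_ternaryOnesCount hy
  rw [h0'] at h
  simp at h

/-- The elements of `ternaryOnesCount v` with first digit `i`, magnified by a factor `3`, cover
`ternaryOnesCount u`. -/
theorem hausdorffMeasure_ternaryOnesCount_le_two_mul {u v : ℕ} {i : ℤ} (h0 : 0 ≤ i) (h3 : i < 3)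
    (hv : v = u + if i = 1 then 1 else 0) :
    μH[Real.log 2 / Real.log 3] (ternaryOnesCount u) ≤ 2 *
      μH[Real.log 2 / Real.log 3] (ternaryOnesCount v ∩ Set.Ico ((i : ℝ) / 3) ((i + 1) / 3)) := by
  have hlip : LipschitzWith 3 fun x : ℝ => 3 * x - i :=
    LipschitzWith.of_dist_le_mul fun x y => by
      rw [Real.dist_eq, Real.dist_eq, sub_sub_sub_cancel_right, ← mul_sub, abs_mul]
      norm_num
  have h := hlip.hausdorffMeasure_image_le log_two_div_log_three_pos.le
    (ternaryOnesCount v ∩ Set.Ico ((i : ℝ) / 3) ((i + 1) / 3))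
  rw [ENNReal.coe_ofNat, ennreal_three_rpow_log_two_div_log_three] at h
  refine (measure_mono fun x hx => ?_).trans h
  refine ⟨(x + i) / 3, ⟨prepend_mem_ternaryOnesCount hx h0 h3 hv, ?_, ?_⟩, by ring⟩
  · linarith [hx.1.1]
  · linarith [hx.1.2]

theorem hausdorffMeasure_ternaryOnesCount_ne_zero (u : ℕ) :
    μH[Real.log 2 / Real.log 3] (ternaryOnesCount u) ≠ 0 := by
  induction u with
  | zero => exact hausdorffMeasure_ternaryOnesCount_zero_ne_zero
  | succ u ih =>
    intro h
    have := hausdorffMeasure_ternaryOnesCount_le_two_mul (u := u) (v := u + 1) (i := 1)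
      (by norm_num) (by norm_num) rfl
    rw [measure_mono_null Set.inter_subset_left h, mul_zero] at this
    exact ih (le_antisymm this zero_le)

theorem hausdorffMeasure_ternaryOnesCount_succ (u : ℕ) :
    μH[Real.log 2 / Real.log 3] (ternaryOnesCount (u + 1)) = ⊤ := by
  set μ : Measure ℝ := μH[Real.log 2 / Real.log 3]
  set S := ternaryOnesCount (u + 1)
  let I : ℤ → Set ℝ := fun i => S ∩ Set.Ico ((i : ℝ) / 3) ((i + 1) / 3)
  have h0 : μ S ≤ 2 * μ (I 0) :=
    hausdorffMeasure_ternaryOnesCount_le_two_mul (by norm_num) (by norm_num) rfl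
  have h1 : μ (ternaryOnesCount u) ≤ 2 * μ (I 1) :=
    hausdorffMeasure_ternaryOnesCount_le_two_mul (by norm_num) (by norm_num) rfl
  have h2 : μ S ≤ 2 * μ (I 2) :=
    hausdorffMeasure_ternaryOnesCount_le_two_mul (by norm_num) (by norm_num) rfl
  have hsum : μ (I 0) + (μ (I 1) + μ (I 2)) ≤ μ S := by
    rw [← measure_inter_add_sdiff S (measurableSet_Iio : MeasurableSet (Set.Iio (1 / 3 : ℝ))),
      ← measure_inter_add_sdiff (S \ Set.Iio (1 / 3 : ℝ))
        (measurableSet_Iio : MeasurableSet (Set.Iio (2 / 3 : ℝ)))]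
    gcongr
    · rintro x ⟨hx, -, h⟩
      exact ⟨hx, by norm_num at h ⊢; linarith⟩
    · rintro x ⟨hx, h, h'⟩
      norm_num at h h'
      exact ⟨⟨hx, by simpa using h⟩, by simp only [Set.mem_Iio]; linarith⟩
    · rintro x ⟨hx, h, -⟩
      norm_num at h
      exact ⟨⟨hx, by simp only [Set.mem_Iio]; linarith⟩, by simp only [Set.mem_Iio]; linarith⟩
  by_contra hS
  have h3 : 2 * μ S + μ (ternaryOnesCount u) ≤ 2 * μ S + 0 := calc
    _ = μ S + (μ (ternaryOnesCount u) + μ S) := by ring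
    _ ≤ 2 * μ (I 0) + (2 * μ (I 1) + 2 * μ (I 2)) := by gcongr
    _ = 2 * (μ (I 0) + (μ (I 1) + μ (I 2))) := by ring
    _ ≤ 2 * μ S := by gcongr
    _ = _ := (add_zero _).symm
  exact hausdorffMeasure_ternaryOnesCount_ne_zero u
    (le_antisymm ((ENNReal.add_le_add_iff_left (ENNReal.mul_ne_top (by norm_num) hS)).1 h3) zero_le)

/-- The integers with `n` ternary digits, all of them `0` or `2`. -/
def cantorIntegers : ℕ → Finset ℤ
  | 0 => {0}
  | n + 1 => (cantorIntegers n).image (fun m => 3 * m) ∪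
      (cantorIntegers n).image (fun m => 3 * m + 2)

theorem card_cantorIntegers_le (n : ℕ) : (cantorIntegers n).card ≤ 2 ^ n := by
  induction n with
  | zero => simp [cantorIntegers]
  | succ n ih =>
    refine (Finset.card_union_le _ _).trans ?_
    rw [pow_succ, mul_two]
    exact add_le_add (Finset.card_image_le.trans ih) (Finset.card_image_le.trans ih)

theorem floor_mem_cantorIntegers {x : ℝ} (hx : x ∈ ternaryOnesCount 0) (n : ℕ) :
    ⌊x * 3 ^ n⌋ ∈ cantorIntegers n := by
  induction n with
  | zero =>
    rw [pow_zero, mul_one, Int.floor_eq_zero_iff.2 hx.1]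
    exact Finset.mem_singleton_self 0
  | succ n ih =>
    have hone : ⌊x * 3 ^ (n + 1)⌋ % 3 ≠ 1 := by
      have h := hx.2
      rw [Nat.cast_zero, Set.encard_eq_zero] at h
      exact fun hn => (h ▸ hn : n ∈ (∅ : Set ℕ))
    have hdiv : ⌊x * 3 ^ n⌋ = ⌊x * 3 ^ (n + 1)⌋ / 3 := by
      have h := Int.floor_div_natCast (x * 3 ^ (n + 1)) 3
      rw [pow_succ, ← mul_assoc] at h ⊢
      simpa using h
    rw [cantorIntegers, Finset.mem_union, Finset.mem_image, Finset.mem_image]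
    rcases (by omega : ⌊x * 3 ^ (n + 1)⌋ % 3 = 0 ∨ ⌊x * 3 ^ (n + 1)⌋ % 3 = 2) with h | h
    · exact Or.inl ⟨_, ih, by omega⟩
    · exact Or.inr ⟨_, ih, by omega⟩

theorem hausdorffMeasure_ternaryOnesCount_zero_le_one :
    μH[Real.log 2 / Real.log 3] (ternaryOnesCount 0) ≤ 1 := by
  have hdiam : ∀ (n : ℕ) (m : ℤ), Metric.ediam (Set.Icc ((m : ℝ) / 3 ^ n) ((m + 1) / 3 ^ n)) =
      ENNReal.ofReal ((1 / 3) ^ n) := fun n m => by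
    rw [Real.ediam_Icc, ← sub_div, add_sub_cancel_left, one_div_pow]
  have hr : Filter.Tendsto (fun n : ℕ => ENNReal.ofReal ((1 / 3) ^ n)) Filter.atTop (nhds 0) := by
    have h := ENNReal.tendsto_ofReal (tendsto_pow_atTop_nhds_zero_of_lt_one (r := (1 / 3 : ℝ))
      (by norm_num) (by norm_num))
    rwa [ENNReal.ofReal_zero] at h
  refine (Measure.hausdorffMeasure_le_liminf_sum (ι := fun n => cantorIntegers n) _ _ _ hr
    (fun n m => Set.Icc ((m : ℝ) / 3 ^ n) ((m + 1) / 3 ^ n))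
    (Filter.Eventually.of_forall fun n m => (hdiam n m).le)
    (Filter.Eventually.of_forall fun n x hx => ?_)).trans ?_
  · refine Set.mem_iUnion.2 ⟨⟨_, floor_mem_cantorIntegers hx n⟩, ?_, ?_⟩
    · exact (div_le_iff₀ (by positivity)).2 (Int.floor_le _)
    · exact (le_div_iff₀ (by positivity)).2 (Int.lt_floor_add_one _).le
  · refine (Filter.liminf_le_liminf (Filter.Eventually.of_forall fun n => ?_)).trans_eq
      (Filter.liminf_const (f := Filter.atTop (α := ℕ)) (1 : ENNReal))
    simp only [hdiam]
    rw [Finset.sum_const, Finset.card_univ, Fintype.card_coe, nsmul_eq_mul,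
      ENNReal.ofReal_rpow_of_nonneg (by positivity) log_two_div_log_three_pos.le,
      one_third_pow_rpow_log_two_div_log_three, one_div_pow, one_div,
      ENNReal.ofReal_inv_of_pos (by positivity), ENNReal.ofReal_pow (by norm_num),
      ENNReal.ofReal_ofNat]
    calc ((cantorIntegers n).card : ENNReal) * (2 ^ n)⁻¹ ≤ 2 ^ n * (2 ^ n)⁻¹ := by
          gcongr
          exact_mod_cast card_cantorIntegers_le n
      _ ≤ 1 := ENNReal.mul_inv_le_one _

theorem ternaryOnesCount_subset_iUnion (u : ℕ) : ternaryOnesCount u ⊆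
    ⋃ p : ℕ × ℤ, (fun x : ℝ => (x + p.2) / 3 ^ p.1) '' ternaryOnesCount 0 := by
  intro x hx
  have hfin : (ternaryOnes x).Finite := Set.finite_of_encard_eq_coe hx.2
  obtain ⟨n, hn⟩ := hfin.bddAbove
  refine Set.mem_iUnion.2 ⟨(n + 1, ⌊x * 3 ^ (n + 1)⌋), Int.fract (x * 3 ^ (n + 1)),
    ⟨⟨Int.fract_nonneg _, Int.fract_lt_one _⟩, ?_⟩, ?_⟩
  · rw [Nat.cast_zero, Set.encard_eq_zero]
    refine Set.eq_empty_of_forall_notMem fun k hk => ?_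
    have hmem : n + 1 + k ∈ ternaryOnes x := by
      have h : x * 3 ^ (n + 1 + k + 1) = Int.fract (x * 3 ^ (n + 1)) * 3 ^ (k + 1) +
          ((⌊x * 3 ^ (n + 1)⌋ * 3 ^ k * 3 : ℤ) : ℝ) := by
        rw [Int.fract]
        push_cast
        ring
      rw [ternaryOnes, Set.mem_ofPred_eq, h, Int.floor_add_intCast, Int.add_mul_emod_self_right]
      exact hk
    have := hn hmem
    omega
  · simp only [Int.fract_add_floor]
    field_simp

theorem dimH_ternaryOnesCount_le (u : ℕ) :
    dimH (ternaryOnesCount u) ≤ ENNReal.ofReal (Real.log 2 / Real.log 3) := by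
  refine (dimH_mono (ternaryOnesCount_subset_iUnion u)).trans ?_
  rw [dimH_iUnion]
  refine iSup_le fun p => ?_
  have hlip : LipschitzWith 1 fun x : ℝ => (x + p.2) / 3 ^ p.1 :=
    LipschitzWith.of_dist_le_mul fun x y => by
      rw [Real.dist_eq, Real.dist_eq, ← sub_div, add_sub_add_right_eq_sub, abs_div, NNReal.coe_one,
        one_mul]
      refine div_le_self (abs_nonneg _) ?_
      rw [abs_of_nonneg (by positivity)]
      exact one_le_pow₀ (by norm_num)
  refine (hlip.dimH_image_le _).trans (dimH_le_of_hausdorffMeasure_ne_top ?_)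
  rw [Real.coe_toNNReal _ log_two_div_log_three_pos.le]
  exact (hausdorffMeasure_ternaryOnesCount_zero_le_one.trans_lt ENNReal.one_lt_top).ne

theorem le_dimH_ternaryOnesCount (u : ℕ) :
    ENNReal.ofReal (Real.log 2 / Real.log 3) ≤ dimH (ternaryOnesCount u) := by
  refine le_dimH_of_hausdorffMeasure_ne_zero ?_
  rw [Real.coe_toNNReal _ log_two_div_log_three_pos.le]
  exact hausdorffMeasure_ternaryOnesCount_ne_zero u



/-- The set `A_u` of `x ∈ [0,1)` whose ternary expansion (the terminating one, given by
digits `j_k = ⌊3^k x⌋ mod 3`) contains the digit `1` exactly `u` times has Hausdorff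
dimension `log 2 / log 3` for every `u ∈ ℕ`, and infinite `(log 2 / log 3)`-dimensional
Hausdorff measure when `u ≥ 1`. -/
theorem ternary_digit_one_count_dimension (u : ℕ) (A : Set ℝ)
    (hA : A = {x ∈ Set.Ico (0 : ℝ) 1 |
      {k : ℕ | ⌊x * 3 ^ (k + 1)⌋ % 3 = 1}.encard = u}) :
    dimH A = ENNReal.ofReal (Real.log 2 / Real.log 3) ∧
    (1 ≤ u → μH[Real.log 2 / Real.log 3] A = ⊤) := by
  subst hA
  refine ⟨le_antisymm (dimH_ternaryOnesCount_le u) (le_dimH_ternaryOnesCount u), fun hu => ?_⟩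
  obtain ⟨v, rfl⟩ := Nat.exists_eq_add_of_le' hu
  exact hausdorffMeasure_ternaryOnesCount_succ v
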